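/- arXiv:2004.09041 — 2 statements merged into one kernel-verified Lean document; each statement's English description precedes it below -/
import Mathlib

section
/- Let ν ∈ O_K be totally positive and let v be the exponent of 𝔭₂ in the ideal (ν). If v is even and v ≥ 4, then r_{2,K}(ν) = 12·σ_{0,χ}(ν). -/
/-!
Statements about sums of squares in K = ℚ(√3), with ring of integers O_K = ℤ[√3],
realized as `Zsqrtd 3`.
-/

noncomputable section

namespace Paper3

/-- π₂ = 1 + √3 in ℤ[√3]. -/
def pi2 : Zsqrtd 3 := ⟨1, 1⟩

/-- The real embedding of ℤ[√3] sending √3 to √3. -/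
def emb (x : Zsqrtd 3) : ℝ := (x.re : ℝ) + (x.im : ℝ) * Real.sqrt 3

/-- The real embedding of ℤ[√3] sending √3 to −√3. -/
def embConj (x : Zsqrtd 3) : ℝ := (x.re : ℝ) - (x.im : ℝ) * Real.sqrt 3

/-- An element of ℤ[√3] is totally positive if its images under both real embeddings
are positive. -/
def TotPos (x : Zsqrtd 3) : Prop := 0 < emb x ∧ 0 < embConj x

/-- `r2 ν` is the number of pairs (x₁,x₂) ∈ O_K² with x₁² + x₂² = ν. -/
def r2 (ν : Zsqrtd 3) : ℕ :=
  Set.ncard {t : Zsqrtd 3 × Zsqrtd 3 | t.1 ^ 2 + t.2 ^ 2 = ν}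

/-- The prime ideal 𝔭₂ = (π₂) of O_K, with (2) = 𝔭₂². -/
def p2 : Ideal (Zsqrtd 3) := Ideal.span {pi2}

open Classical in
/-- χ(𝔞) = sgn(N_{K/ℚ}(μ)) for a generator μ of a nonzero ideal 𝔞 coprime to 𝔭₂,
and χ(𝔞) = 0 for 𝔞 not coprime to 𝔭₂ (well defined since every unit has norm 1). -/
def chiIdeal (I : Ideal (Zsqrtd 3)) : ℤ :=
  if h : ∃ μ : Zsqrtd 3, I = Ideal.span {μ} then
    if I ⊔ p2 = ⊤ then Int.sign (Zsqrtd.norm h.choose) else 0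
  else 0

/-- σ_{0,χ}(ν) = Σ_{𝔞 ∣ (ν)} χ(𝔞), the sum over all nonzero ideals 𝔞 dividing (ν). -/
def sigmaChi (ν : Zsqrtd 3) : ℤ :=
  ∑ᶠ I ∈ {I : Ideal (Zsqrtd 3) | I ∣ Ideal.span {ν}}, chiIdeal I

/-! ### Arithmetic of `ℤ[√3]` -/

theorem isPrincipalIdealRing_of_euclidean {A : Type*} [CommRing A] (n : A → ℕ)
    (h : ∀ a b : A, b ≠ 0 → ∃ q, n (a - b * q) < n b) : IsPrincipalIdealRing A := by
  refine ⟨fun I => ?_⟩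
  by_cases hI : I = ⊥
  · subst hI; infer_instance
  obtain ⟨c, hcI, hc0⟩ := Submodule.exists_mem_ne_zero_of_ne_bot hI
  obtain ⟨b, ⟨hbI, hb0⟩, hmin⟩ :=
    WellFounded.has_min (measure n).wf {b | b ∈ I ∧ b ≠ 0} ⟨c, hcI, hc0⟩
  refine ⟨b, le_antisymm (fun a ha => ?_) ((Ideal.span_singleton_le_iff_mem I).2 hbI)⟩
  obtain ⟨q, hq⟩ := h a b hb0
  have hmem : a - b * q ∈ I := I.sub_mem ha (I.mul_mem_right q hbI)
  have h0 : a - b * q = 0 := by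
    by_contra hne
    exact hmin _ ⟨hmem, hne⟩ hq
  exact Ideal.mem_span_singleton.2 ⟨q, sub_eq_zero.1 h0⟩

theorem three_ne_mul_self (n : ℤ) : (3 : ℤ) ≠ n * n := by
  intro h
  have h1 : n < 2 := by nlinarith
  have h2 : -2 < n := by nlinarith
  interval_cases n <;> omega

theorem norm_eq_zero_iff (x : Zsqrtd 3) : x.norm = 0 ↔ x = 0 :=
  Zsqrtd.norm_eq_zero three_ne_mul_self x

instance instIsDomainZsqrtdThree : IsDomain (Zsqrtd 3) := by
  have : NoZeroDivisors (Zsqrtd 3) := ⟨fun {a b} h => by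
    have := congrArg Zsqrtd.norm h
    rw [Zsqrtd.norm_mul, Zsqrtd.norm_zero, mul_eq_zero, norm_eq_zero_iff,
      norm_eq_zero_iff] at this
    exact this⟩
  have : Nontrivial (Zsqrtd 3) := ⟨0, 1, by decide⟩
  exact NoZeroDivisors.to_isDomain _

/-- Division with remainder of least absolute value. -/
theorem exists_two_mul_abs_sub_le (a M : ℤ) (hM : 0 < M) : ∃ q, 2 * |a - M * q| ≤ M := by
  refine ⟨(2 * a + M) / (2 * M), ?_⟩
  have h1 := Int.emod_add_mul_ediv (2 * a + M) (2 * M)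
  have h2 := Int.emod_nonneg (2 * a + M) (show 2 * M ≠ 0 by omega)
  have h3 := Int.emod_lt_of_pos (2 * a + M) (show 0 < 2 * M by omega)
  generalize (2 * a + M) / (2 * M) = q at *
  rcases abs_cases (a - M * q) with ⟨h, _⟩ | ⟨h, _⟩ <;> rw [h] <;> nlinarith

instance instIsPrincipalIdealRingZsqrtdThree : IsPrincipalIdealRing (Zsqrtd 3) := by
  refine isPrincipalIdealRing_of_euclidean (fun x => x.norm.natAbs) fun a b hb => ?_
  have hb0 : b.norm ≠ 0 := fun h => hb ((norm_eq_zero_iff b).1 h)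
  have hM : 0 < |b.norm| := abs_pos.2 hb0
  obtain ⟨q, hq⟩ := exists_two_mul_abs_sub_le (a * star b).re |b.norm| hM
  obtain ⟨r, hr⟩ := exists_two_mul_abs_sub_le (a * star b).im |b.norm| hM
  set s := b.norm.sign
  have hs : |b.norm| = b.norm * s := by rw [Int.mul_sign_self, Int.natCast_natAbs]
  refine ⟨⟨s * q, s * r⟩, ?_⟩
  have key : (a - b * ⟨s * q, s * r⟩) * star b =
      ⟨(a * star b).re - |b.norm| * q, (a * star b).im - |b.norm| * r⟩ := by
    rw [hs, sub_mul, mul_right_comm, ← Zsqrtd.norm_eq_mul_conj]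
    ext <;> simp <;> ring
  have key2 := congrArg Zsqrtd.norm key
  rw [Zsqrtd.norm_mul, Zsqrtd.norm_conj] at key2
  generalize (a * star b).re - |b.norm| * q = u at *
  generalize (a * star b).im - |b.norm| * r = v at *
  simp only [Zsqrtd.norm_def ⟨u, v⟩] at key2
  have hu : 4 * (u * u) ≤ |b.norm| * |b.norm| := by
    rw [← abs_mul_abs_self u]; nlinarith [abs_nonneg u]
  have hv : 4 * (v * v) ≤ |b.norm| * |b.norm| := by
    rw [← abs_mul_abs_self v]; nlinarith [abs_nonneg v]
  have hlt : |u * u - 3 * v * v| < |b.norm| * |b.norm| := by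
    rw [abs_lt]; constructor <;> nlinarith [mul_self_nonneg u, mul_self_nonneg v]
  rw [← key2, abs_mul] at hlt
  have := lt_of_mul_lt_mul_right hlt hM.le
  zify
  exact this

theorem totPos_iff (x : Zsqrtd 3) : TotPos x ↔ 0 < x.re ∧ 0 < x.norm := by
  have h3 : Real.sqrt 3 * Real.sqrt 3 = 3 := Real.mul_self_sqrt (by norm_num)
  have hprod : emb x * embConj x = ((x.norm : ℤ) : ℝ) := by
    simp only [emb, embConj, Zsqrtd.norm_def]
    push_cast
    linear_combination -(x.im : ℝ) * x.im * h3
  have hsum : emb x + embConj x = 2 * (x.re : ℝ) := by simp only [emb, embConj]; ring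
  constructor
  · rintro ⟨h1, h2⟩
    refine ⟨?_, ?_⟩
    · have : (0 : ℝ) < x.re := by linarith
      exact_mod_cast this
    · have := mul_pos h1 h2
      rw [hprod] at this
      exact_mod_cast this
  · rintro ⟨h1, h2⟩
    have h1' : (0 : ℝ) < x.re := by exact_mod_cast h1
    have h2' : (0 : ℝ) < (x.norm : ℤ) := by exact_mod_cast h2
    rw [← hprod] at h2'
    rcases pos_and_pos_or_neg_and_neg_of_mul_pos h2' with h | h
    · exact h
    · linarith [h.1, h.2]

theorem TotPos.norm_pos {x : Zsqrtd 3} (h : TotPos x) : 0 < x.norm := ((totPos_iff x).1 h).2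

theorem TotPos.ne_zero {x : Zsqrtd 3} (h : TotPos x) : x ≠ 0 := by
  rintro rfl
  simpa using h.norm_pos

theorem emb_mul (x y : Zsqrtd 3) : emb (x * y) = emb x * emb y := by
  have h3 : Real.sqrt 3 * Real.sqrt 3 = 3 := Real.mul_self_sqrt (by norm_num)
  simp only [emb, Zsqrtd.re_mul, Zsqrtd.im_mul]
  push_cast
  linear_combination -(x.im : ℝ) * y.im * h3

theorem embConj_mul (x y : Zsqrtd 3) : embConj (x * y) = embConj x * embConj y := by
  have h3 : Real.sqrt 3 * Real.sqrt 3 = 3 := Real.mul_self_sqrt (by norm_num)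
  simp only [embConj, Zsqrtd.re_mul, Zsqrtd.im_mul]
  push_cast
  linear_combination -(x.im : ℝ) * y.im * h3

theorem TotPos.mul_iff {x y : Zsqrtd 3} (hx : TotPos x) : TotPos (x * y) ↔ TotPos y := by
  simp only [TotPos, emb_mul, embConj_mul, mul_pos_iff_of_pos_left hx.1,
    mul_pos_iff_of_pos_left hx.2]

theorem totPos_mul_self {x : Zsqrtd 3} (hx : x ≠ 0) : TotPos (x * x) := by
  have h : x.norm ≠ 0 := fun h => hx ((norm_eq_zero_iff x).1 h)
  rw [totPos_iff, Zsqrtd.norm_mul]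
  refine ⟨?_, mul_self_pos.2 h⟩
  have h' : x.re * x.re - 3 * x.im * x.im ≠ 0 := h
  rw [Zsqrtd.re_mul]
  by_contra hle
  have h1 : x.re = 0 := by nlinarith [mul_self_nonneg x.re, mul_self_nonneg x.im]
  have h2 : x.im = 0 := by nlinarith [mul_self_nonneg x.re, mul_self_nonneg x.im]
  simp [h1, h2] at h'

theorem norm_eq_one_of_isUnit {u : Zsqrtd 3} (hu : IsUnit u) : u.norm = 1 := by
  rcases Int.isUnit_iff.1 ((Zsqrtd.isUnit_iff_norm_isUnit u).1 hu) with h | h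
  · exact h
  · exfalso
    rw [Zsqrtd.norm_def] at h
    have h4 : (u.re * u.re + u.im * u.im) % 4 = 3 := by
      have : u.re * u.re + u.im * u.im = 4 * (u.im * u.im) - 1 := by linarith
      omega
    rcases Int.emod_two_eq_zero_or_one u.re with h1 | h1 <;>
      rcases Int.emod_two_eq_zero_or_one u.im with h2 | h2 <;>
      obtain ⟨k, hk⟩ : ∃ k, u.re = 2 * k + u.re % 2 := ⟨u.re / 2, by omega⟩ <;>
      obtain ⟨l, hl⟩ : ∃ l, u.im = 2 * l + u.im % 2 := ⟨u.im / 2, by omega⟩ <;>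
      rw [h1] at hk <;> rw [h2] at hl <;> rw [hk, hl] at h4 <;> ring_nf at h4 <;> omega

/-- Associated elements of `ℤ[√3]` have the same norm. -/
theorem norm_eq_of_associated {x y : Zsqrtd 3} (h : Associated x y) : x.norm = y.norm := by
  obtain ⟨u, rfl⟩ := h
  rw [Zsqrtd.norm_mul, norm_eq_one_of_isUnit u.isUnit, mul_one]

/-- Totally positive units are powers of `2 + √3`. -/
theorem exists_eq_zpow_of_totPos {u : Zsqrtd 3} (hu : IsUnit u) (hpos : TotPos u) :
    ∃ (e : (Zsqrtd 3)ˣ) (k : ℤ), (e : Zsqrtd 3) = ⟨2, 1⟩ ∧ u = ((e ^ k : (Zsqrtd 3)ˣ) : Zsqrtd 3) := by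
  have hfund : Pell.IsFundamental (Pell.Solution₁.mk (d := 3) 2 1 (by norm_num)) := by
    refine ⟨by simp, by simp, fun {b} hb => ?_⟩
    simp only [Pell.Solution₁.x_mk]
    omega
  set a := Pell.Solution₁.mk (d := 3) 2 1 (by norm_num)
  have hn := norm_eq_one_of_isUnit hu
  obtain ⟨k, hk⟩ := hfund.eq_zpow_or_neg_zpow
    ⟨u, Zsqrtd.norm_eq_one_iff_mem_unitary.1 hn⟩
  let f : Pell.Solution₁ 3 →* (Zsqrtd 3)ˣ := Unitary.toUnits
  refine ⟨f a, k, rfl, ?_⟩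
  rw [← map_zpow]
  have hx : 0 < (a ^ k).x := Pell.Solution₁.x_zpow_pos (by simp [a]) k
  rcases hk with hk | hk
  · exact congrArg Subtype.val hk
  · have h1 := congrArg Subtype.val hk
    have h2 : u.re = -(a ^ k).x := congrArg Zsqrtd.re h1
    have := ((totPos_iff u).1 hpos).1
    omega

theorem prime_pi2 : Prime pi2 := by
  refine Irreducible.prime ⟨?_, fun {a b} hab => ?_⟩
  · intro h
    exact absurd (norm_eq_one_of_isUnit h) (by decide)
  · have h := congrArg (fun x => x.norm.natAbs) hab
    simp only [Zsqrtd.norm_mul, Int.natAbs_mul] at h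
    have h2 : pi2.norm.natAbs = 2 := by decide
    rw [h2] at h
    rw [← Zsqrtd.norm_eq_one_iff, ← Zsqrtd.norm_eq_one_iff]
    have := Nat.prime_two.isUnit_or_isUnit h
    simpa using this

/-! ### Arithmetic of `ℤ[ζ₁₂]` -/

/-- The ring `ℤ[ζ₁₂]`, as the quadratic extension `ℤ[√3][ζ]` with `ζ² = √3 ζ - 1`. -/
abbrev Cyc : Type := QuadraticAlgebra (Zsqrtd 3) (-1) Zsqrtd.sqrtd

namespace Cyc

open QuadraticAlgebra

theorem norm_re (z : Cyc) : z.norm.re =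
    (z.re.re * z.re.re + 3 * z.re.re * z.im.im + 3 * z.im.im * z.im.im) +
    (z.im.re * z.im.re + 3 * z.im.re * z.re.im + 3 * z.re.im * z.re.im) := by
  simp [QuadraticAlgebra.norm_def]
  ring

theorem norm_im (z : Cyc) : z.norm.im =
    2 * z.re.re * z.re.im + z.re.re * z.im.re + 3 * z.re.im * z.im.im +
      2 * z.im.re * z.im.im := by
  simp [QuadraticAlgebra.norm_def]
  ring

theorem norm_eq_zero_iff (z : Cyc) : z.norm = 0 ↔ z = 0 := by
  refine ⟨fun h => ?_, by rintro rfl; simp⟩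
  have h1 : z.norm.re = 0 := by rw [h]; rfl
  rw [norm_re] at h1
  have e1 : z.im.im = 0 := by
    nlinarith [sq_nonneg (2 * z.re.re + 3 * z.im.im), sq_nonneg (2 * z.im.re + 3 * z.re.im),
      sq_nonneg z.im.im, sq_nonneg z.re.im]
  have e2 : z.re.im = 0 := by
    nlinarith [sq_nonneg (2 * z.re.re + 3 * z.im.im), sq_nonneg (2 * z.im.re + 3 * z.re.im),
      sq_nonneg z.im.im, sq_nonneg z.re.im]
  simp only [e1, e2] at h1
  have e3 : z.re.re = 0 := by nlinarith [sq_nonneg z.re.re, sq_nonneg z.im.re]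
  have e4 : z.im.re = 0 := by nlinarith [sq_nonneg z.re.re, sq_nonneg z.im.re]
  ext <;> simp [e1, e2, e3, e4]

instance instIsDomain : IsDomain Cyc := by
  have : NoZeroDivisors Cyc := ⟨fun {a b} h => by
    have := congrArg QuadraticAlgebra.norm h
    rw [map_mul, QuadraticAlgebra.norm_zero, mul_eq_zero, norm_eq_zero_iff,
      norm_eq_zero_iff] at this
    exact this⟩
  exact NoZeroDivisors.to_isDomain _

theorem totPos_norm {z : Cyc} (hz : z ≠ 0) : TotPos z.norm := by
  rw [totPos_iff]
  have h0 : z.norm ≠ 0 := fun h => hz ((norm_eq_zero_iff z).1 h)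
  have h3 : Real.sqrt 3 * Real.sqrt 3 = 3 := Real.mul_self_sqrt (by norm_num)
  have e1 : 0 ≤ emb z.norm := by
    have : emb z.norm = (emb z.re + Real.sqrt 3 / 2 * emb z.im) ^ 2 + emb z.im ^ 2 / 4 := by
      simp only [emb, norm_re, norm_im]
      push_cast
      grind
    rw [this]; positivity
  have e2 : 0 ≤ embConj z.norm := by
    have : embConj z.norm =
        (embConj z.re - Real.sqrt 3 / 2 * embConj z.im) ^ 2 + embConj z.im ^ 2 / 4 := by
      simp only [embConj, norm_re, norm_im]
      push_cast
      grind
    rw [this]; positivity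
  rw [← totPos_iff]
  have hprod : emb z.norm * embConj z.norm = ((z.norm.norm : ℤ) : ℝ) := by
    simp only [emb, embConj, Zsqrtd.norm_def]
    push_cast
    linear_combination -(z.norm.im : ℝ) * z.norm.im * h3
  have hne : emb z.norm * embConj z.norm ≠ 0 := by
    rw [hprod]
    exact_mod_cast fun h => h0 ((Paper3.norm_eq_zero_iff _).1 h)
  exact ⟨lt_of_le_of_ne e1 (left_ne_zero_of_mul hne).symm,
    lt_of_le_of_ne e2 (right_ne_zero_of_mul hne).symm⟩

theorem exists_form_lt_of_le {c d M : ℤ} (hM : 0 < M) (hc : 2 * |c| ≤ M) (hd : 2 * |d| ≤ M) :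
    ∃ q r, 2 * ((c - M * q) ^ 2 + (c - M * q) * (d - M * r) + (d - M * r) ^ 2) < M ^ 2 := by
  by_cases hf : 2 * (c ^ 2 + c * d + d ^ 2) < M ^ 2
  · exact ⟨0, 0, by simpa using hf⟩
  rw [not_lt] at hf
  obtain ⟨hc1, hc2⟩ := abs_le.1 (show |2 * c| ≤ M by rwa [abs_mul])
  obtain ⟨hd1, hd2⟩ := abs_le.1 (show |2 * d| ≤ M by rwa [abs_mul])
  have hcc : 4 * c ^ 2 ≤ M ^ 2 := by nlinarith
  have hdd : 4 * d ^ 2 ≤ M ^ 2 := by nlinarith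
  have hcd : 0 ≤ c * d := by nlinarith
  rcases le_total 0 c with h1 | h1 <;> rcases le_total 0 d with h2 | h2
  · have hs : 2 * M < 3 * (c + d) := by
      by_contra hcon
      nlinarith
    rcases le_total d c with h | h
    · refine ⟨1, 0, ?_⟩
      nlinarith
    · refine ⟨0, 1, ?_⟩
      nlinarith
  · have : c * d = 0 := le_antisymm (mul_nonpos_of_nonneg_of_nonpos h1 h2) hcd
    rcases mul_eq_zero.1 this with h | h <;> subst h <;> nlinarith
  · have : c * d = 0 := le_antisymm (mul_nonpos_of_nonpos_of_nonneg h1 h2) hcd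
    rcases mul_eq_zero.1 this with h | h <;> subst h <;> nlinarith
  · have hs : 3 * (c + d) < - (2 * M) := by
      by_contra hcon
      nlinarith
    rcases le_total d c with h | h
    · refine ⟨0, -1, ?_⟩
      nlinarith
    · refine ⟨-1, 0, ?_⟩
      nlinarith

theorem exists_form_lt (a b M : ℤ) (hM : 0 < M) : ∃ q r,
    2 * ((a - M * q) * (a - M * q) + 3 * (a - M * q) * (b - M * r) +
      3 * (b - M * r) * (b - M * r)) < M ^ 2 := by
  obtain ⟨q₁, h₁⟩ := exists_two_mul_abs_sub_le (a + b) M hM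
  obtain ⟨r₁, h₂⟩ := exists_two_mul_abs_sub_le b M hM
  obtain ⟨q₂, r₂, h⟩ := exists_form_lt_of_le hM h₁ h₂
  refine ⟨q₁ + q₂ - (r₁ + r₂), r₁ + r₂, lt_of_eq_of_lt ?_ h⟩
  ring

theorem form_nonneg (a b : ℤ) : 0 ≤ a * a + 3 * a * b + 3 * b * b := by
  nlinarith [sq_nonneg (2 * a + 3 * b), sq_nonneg b]

instance instIsPrincipalIdealRing : IsPrincipalIdealRing Cyc := by
  refine isPrincipalIdealRing_of_euclidean (fun z => z.norm.norm.natAbs) fun a b hb => ?_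
  have hM : 0 < b.norm.norm := (totPos_norm hb).norm_pos
  set M := b.norm.norm
  set b' : Cyc := star b * algebraMap _ _ (star b.norm)
  have hbb : b * b' = algebraMap (Zsqrtd 3) Cyc (M : Zsqrtd 3) := by
    rw [← mul_assoc, ← algebraMap_norm_eq_mul_star, ← map_mul, ← Zsqrtd.norm_eq_mul_conj]
  have hb' : b' ≠ 0 := by
    intro h
    rw [h, mul_zero] at hbb
    have := congrArg (fun z : Cyc => z.re.re) hbb
    simp at this
    omega
  have hM' : 0 < b'.norm.norm := (totPos_norm hb').norm_pos
  obtain ⟨q₁, q₂, h1⟩ := exists_form_lt (a * b').re.re (a * b').im.im M hM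
  obtain ⟨q₃, q₄, h2⟩ := exists_form_lt (a * b').im.re (a * b').re.im M hM
  refine ⟨⟨⟨q₁, q₄⟩, ⟨q₃, q₂⟩⟩, ?_⟩
  have key : (a - b * ⟨⟨q₁, q₄⟩, ⟨q₃, q₂⟩⟩) * b' =
      ⟨⟨(a * b').re.re - M * q₁, (a * b').re.im - M * q₄⟩,
        ⟨(a * b').im.re - M * q₃, (a * b').im.im - M * q₂⟩⟩ := by
    rw [sub_mul, mul_right_comm, hbb]
    generalize a * b' = c
    ext <;> simp
  have hA := norm_re ((a - b * ⟨⟨q₁, q₄⟩, ⟨q₃, q₂⟩⟩) * b')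
  rw [key] at hA
  simp only at hA
  have hA0 : 0 ≤ (((a - b * ⟨⟨q₁, q₄⟩, ⟨q₃, q₂⟩⟩) * b').norm).re := by
    rw [norm_re]; exact add_nonneg (form_nonneg _ _) (form_nonneg _ _)
  rw [← key] at hA
  have hAM : (((a - b * ⟨⟨q₁, q₄⟩, ⟨q₃, q₂⟩⟩) * b').norm).re < M ^ 2 := by
    rw [hA]; linarith
  have hlt : (((a - b * ⟨⟨q₁, q₄⟩, ⟨q₃, q₂⟩⟩) * b').norm).norm < M * b'.norm.norm := by
    have e : M * b'.norm.norm = M ^ 4 := by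
      have := congrArg (fun z : Cyc => z.norm.norm) hbb
      simp only [map_mul, Zsqrtd.norm_mul, QuadraticAlgebra.norm_algebraMap, pow_two,
        Zsqrtd.norm_intCast] at this
      change M * b'.norm.norm = _ at this
      rw [this]; ring
    rw [e, Zsqrtd.norm_def]
    nlinarith [mul_self_nonneg (((a - b * ⟨⟨q₁, q₄⟩, ⟨q₃, q₂⟩⟩) * b').norm).im]
  rw [map_mul, Zsqrtd.norm_mul] at hlt
  have h := lt_of_mul_lt_mul_right hlt hM'.le
  have h0 : 0 ≤ (a - b * ⟨⟨q₁, q₄⟩, ⟨q₃, q₂⟩⟩ : Cyc).norm.norm := by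
    by_cases hz : (a - b * ⟨⟨q₁, q₄⟩, ⟨q₃, q₂⟩⟩ : Cyc) = 0
    · rw [hz]; simp
    · exact (totPos_norm hz).norm_pos.le
  omega

/-! ### Splitting of primes in `ℤ[ζ₁₂] / ℤ[√3]` -/

theorem isUnit_iff (z : Cyc) : IsUnit z ↔ IsUnit z.norm :=
  isUnit_iff_norm_isUnit

theorem prime_of_prime_norm {z : Cyc} (h : Prime z.norm) : Prime z := by
  refine Irreducible.prime ⟨fun hu => h.not_isUnit ((isUnit_iff z).1 hu), fun {a b} hab => ?_⟩
  rw [isUnit_iff a, isUnit_iff b]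
  exact h.irreducible.isUnit_or_isUnit (by rw [hab, map_mul])

/-- A prime of `ℤ[√3]` that does not stay prime in `ℤ[ζ₁₂]` is a norm up to units. -/
theorem exists_associated_norm_of_not_prime {p : Zsqrtd 3} (hp : Prime p)
    (h : ¬ Prime (algebraMap (Zsqrtd 3) Cyc p)) : ∃ r : Cyc, Associated r.norm p := by
  have hnu : ¬ IsUnit (algebraMap (Zsqrtd 3) Cyc p) := by
    rw [isUnit_iff, QuadraticAlgebra.norm_algebraMap, isUnit_pow_iff two_ne_zero]
    exact hp.not_isUnit
  rw [← irreducible_iff_prime, irreducible_iff] at h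
  simp only [hnu, not_false_eq_true, true_and] at h
  push Not at h
  obtain ⟨a, b, hab, ha, hb⟩ := h
  rw [isUnit_iff] at ha hb
  have hn : p ^ 2 = a.norm * b.norm := by
    rw [← map_mul, ← hab, QuadraticAlgebra.norm_algebraMap]
  obtain ⟨i, hi, hassoc⟩ := (dvd_prime_pow hp 2).1 ⟨b.norm, hn⟩
  interval_cases i
  · exact absurd ((associated_one_iff_isUnit).1 (by simpa using hassoc)) ha
  · exact ⟨a, by simpa using hassoc⟩
  · exfalso
    obtain ⟨u, hu⟩ := hassoc
    rw [← hu] at hn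
    have ha0 : a.norm ≠ 0 := by
      rintro h
      rw [h, zero_mul] at hu
      exact pow_ne_zero 2 hp.ne_zero hu.symm
    exact hb (mul_left_cancel₀ ha0 hn ▸ u.isUnit)

theorem prime_algebraMap_of_norm_neg {p : Zsqrtd 3} (hp : Prime p) (hneg : p.norm < 0) :
    Prime (algebraMap (Zsqrtd 3) Cyc p) := by
  by_contra h
  obtain ⟨r, hr⟩ := exists_associated_norm_of_not_prime hp h
  have h0 : r ≠ 0 := by
    rintro rfl
    rw [QuadraticAlgebra.norm_zero] at hr
    exact hp.ne_zero ((Associated.eq_zero_iff hr).1 rfl)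
  have := (totPos_norm h0).norm_pos
  rw [norm_eq_of_associated hr] at this
  omega

theorem dvd_of_algebraMap_dvd_star {p : Zsqrtd 3} {z : Cyc}
    (h : algebraMap (Zsqrtd 3) Cyc p ∣ star z) : algebraMap (Zsqrtd 3) Cyc p ∣ z := by
  rw [algebraMap_dvd_iff, re_star, im_star] at h
  rw [algebraMap_dvd_iff]
  have h2 := (dvd_neg).1 h.2
  exact ⟨(dvd_add_left (h2.mul_left _)).1 h.1, h2⟩

theorem pi2_dvd_of_dvd_two {p : Zsqrtd 3} (hp : Prime p) (h : p ∣ 2) : pi2 ∣ p := by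
  have h2 : (2 : Zsqrtd 3) ∣ pi2 * pi2 := ⟨⟨2, 1⟩, by decide⟩
  have h3 : p ∣ pi2 := (hp.dvd_or_dvd (h.trans h2)).elim id id
  exact (hp.associated_of_dvd prime_pi2 h3).symm.dvd

theorem exists_prime_nat_dvd {p : Zsqrtd 3} (hp : Prime p) :
    ∃ q : ℕ, q.Prime ∧ p ∣ (q : Zsqrtd 3) := by
  have key : ∀ n : ℕ, n ≠ 0 → p ∣ (n : Zsqrtd 3) → ∃ q : ℕ, q.Prime ∧ p ∣ (q : Zsqrtd 3) := by
    intro n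
    induction n using Nat.recOnMul with
    | zero => simp
    | one => intro _ h; exact absurd (isUnit_of_dvd_one (by simpa using h)) hp.not_isUnit
    | prime q hq => exact fun _ h => ⟨q, hq, h⟩
    | mul a b iha ihb =>
      intro h0 h
      rw [Nat.cast_mul] at h
      rcases hp.dvd_or_dvd h with h | h
      · exact iha (left_ne_zero_of_mul h0) h
      · exact ihb (right_ne_zero_of_mul h0) h
  have h0 : p.norm ≠ 0 := fun h => hp.ne_zero ((Paper3.norm_eq_zero_iff p).1 h)
  refine key p.norm.natAbs (by simpa using h0) ?_
  have h1 : p ∣ (p.norm : Zsqrtd 3) := ⟨star p, Zsqrtd.norm_eq_mul_conj p⟩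
  rcases Int.natAbs_eq p.norm with h | h
  · rw [h] at h1; simpa using h1
  · rw [h] at h1; simpa using h1

theorem exists_dvd_mul_self_add_one_of_mod_four {p : Zsqrtd 3} {q : ℕ} (hq : q.Prime)
    (hpq : p ∣ (q : Zsqrtd 3)) (h4 : q % 4 ≠ 3) : ∃ x : Zsqrtd 3, p ∣ x * x + 1 := by
  have : Fact q.Prime := ⟨hq⟩
  obtain ⟨y, hy⟩ := ZMod.exists_sq_eq_neg_one_iff.2 h4
  obtain ⟨k, rfl⟩ := ZMod.intCast_surjective y
  have h : ((k * k + 1 : ℤ) : ZMod q) = 0 := by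
    push_cast; rw [← hy]; ring
  obtain ⟨m, hm⟩ := (ZMod.intCast_zmod_eq_zero_iff_dvd _ _).1 h
  refine ⟨k, hpq.trans ⟨m, ?_⟩⟩
  exact_mod_cast congrArg (Int.cast : ℤ → Zsqrtd 3) hm

/-- `-1` is a square modulo any prime of `ℤ[√3]` of positive norm. -/
theorem exists_dvd_mul_self_add_one {p : Zsqrtd 3} (hp : Prime p)
    (hpos : 0 < p.norm) : ∃ x : Zsqrtd 3, p ∣ x * x + 1 := by
  obtain ⟨q, hq, hpq⟩ := exists_prime_nat_dvd hp
  by_cases h4 : q % 4 = 3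
  swap
  · exact exists_dvd_mul_self_add_one_of_mod_four hq hpq h4
  have : Fact q.Prime := ⟨hq⟩
  obtain ⟨t, ht⟩ := hpq
  have hn : (q : ℤ) ^ 2 = p.norm * t.norm := by
    rw [← Zsqrtd.norm_mul, ← ht, Zsqrtd.norm_natCast, pow_two]
  have hn' : q ^ 2 = p.norm.natAbs * t.norm.natAbs := by
    rw [← Int.natAbs_mul, ← hn, Int.natAbs_pow, Int.natAbs_natCast]
  obtain ⟨i, hi, hpi⟩ := (Nat.dvd_prime_pow hq).1 ⟨_, hn'⟩
  have hpabs : (p.norm.natAbs : ℤ) = p.norm := Int.natAbs_of_nonneg hpos.le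
  interval_cases i
  · exact absurd (Zsqrtd.norm_eq_one_iff.1 (by simpa using hpi)) hp.not_isUnit
  · exfalso
    rw [pow_one] at hpi
    rw [hpi, Zsqrtd.norm_def] at hpabs
    have h5 : (p.re * p.re + p.im * p.im) % 4 = 3 := by
      have : p.re * p.re + p.im * p.im = 4 * (p.im * p.im) + q := by linarith
      omega
    rcases Int.emod_two_eq_zero_or_one p.re with h1 | h1 <;>
      rcases Int.emod_two_eq_zero_or_one p.im with h2 | h2 <;>
      obtain ⟨k, hk⟩ : ∃ k, p.re = 2 * k + p.re % 2 := ⟨p.re / 2, by omega⟩ <;>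
      obtain ⟨l, hl⟩ : ∃ l, p.im = 2 * l + p.im % 2 := ⟨p.im / 2, by omega⟩ <;>
      rw [h1] at hk <;> rw [h2] at hl <;> rw [hk, hl] at h5 <;> ring_nf at h5 <;> omega
  · have ht1 : t.norm.natAbs = 1 := by
      rw [hpi] at hn'
      exact Nat.eq_of_mul_eq_mul_left (pow_pos hq.pos 2) (by rw [mul_one, ← hn'])
    have hqp : Prime (q : Zsqrtd 3) := by
      rw [ht]
      exact (associated_mul_unit_right p t (Zsqrtd.norm_eq_one_iff.1 ht1)).prime hp
    have h3 : ¬ IsSquare (3 : ZMod q) := by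
      rintro ⟨y, hy⟩
      obtain ⟨k, rfl⟩ := ZMod.intCast_surjective y
      have h : ((k * k - 3 : ℤ) : ZMod q) = 0 := by
        push_cast; rw [← hy]; ring
      obtain ⟨m, hm⟩ := (ZMod.intCast_zmod_eq_zero_iff_dvd _ _).1 h
      have hd : ((q : ℤ) : Zsqrtd 3) ∣ ⟨k, 1⟩ * ⟨k, -1⟩ := by
        refine ⟨m, ?_⟩
        rw [← Int.cast_mul, ← hm]
        ext
        · simp
          ring
        · simp
      have hq1 : ¬ (q : ℤ) ∣ 1 := fun h => hq.one_lt.ne' (by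
        exact Nat.dvd_one.1 (by exact_mod_cast h))
      rcases (show Prime ((q : ℤ) : Zsqrtd 3) by exact_mod_cast hqp).dvd_or_dvd hd with h | h
      · rw [Zsqrtd.intCast_dvd] at h
        exact hq1 h.2
      · rw [Zsqrtd.intCast_dvd] at h
        exact hq1 ((dvd_neg).1 h.2)
    have h1 : ¬ IsSquare (-1 : ZMod q) := fun h => ZMod.exists_sq_eq_neg_one_iff.1 h h4
    have h30 : (3 : ZMod q) ≠ 0 := fun h => h3 (h ▸ IsSquare.zero)
    obtain ⟨y, hy⟩ : IsSquare (-1 * 3 : ZMod q) := by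
      rw [← quadraticChar_one_iff_isSquare (mul_ne_zero (neg_ne_zero.2 one_ne_zero) h30), map_mul,
        quadraticChar_neg_one_iff_not_isSquare.2 h3, quadraticChar_neg_one_iff_not_isSquare.2 h1]
      rfl
    obtain ⟨k, hk⟩ := ZMod.intCast_surjective (y / 3)
    have h : ((3 * (k * k) + 1 : ℤ) : ZMod q) = 0 := by
      push_cast
      rw [hk]
      field_simp
      linear_combination -hy
    obtain ⟨m, hm⟩ := (ZMod.intCast_zmod_eq_zero_iff_dvd _ _).1 h
    refine ⟨⟨0, k⟩, (Dvd.intro t ht.symm).trans ⟨m, ?_⟩⟩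
    have e : (⟨0, k⟩ * ⟨0, k⟩ + 1 : Zsqrtd 3) = ((3 * (k * k) + 1 : ℤ) : Zsqrtd 3) := by
      ext
      · simp
        ring
      · simp
    rw [e, hm]
    push_cast
    rfl

/-- An odd prime of positive norm splits into two non-associated conjugate primes. -/
theorem exists_split {p : Zsqrtd 3} (hp : Prime p) (hodd : ¬ pi2 ∣ p) (hpos : 0 < p.norm) :
    ∃ r : Cyc, Associated r.norm p ∧ ¬ Associated r (star r) := by
  obtain ⟨x, hx⟩ := exists_dvd_mul_self_add_one hp hpos
  have hp2 : ¬ p ∣ 2 := fun h => hodd (pi2_dvd_of_dvd_two hp h)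
  set w : Cyc := ⟨x - Zsqrtd.sqrtd, 2⟩
  have hw : w * star w = algebraMap (Zsqrtd 3) Cyc (x * x + 1) := by
    have h3 : (Zsqrtd.sqrtd * Zsqrtd.sqrtd : Zsqrtd 3) = 3 := by decide
    rw [← algebraMap_norm_eq_mul_star]
    congr 1
    simp only [QuadraticAlgebra.norm_def, w]
    linear_combination (-1) * h3
  have hnp : ¬ Prime (algebraMap (Zsqrtd 3) Cyc p) := by
    intro h
    have hdvd : algebraMap (Zsqrtd 3) Cyc p ∣ w * star w := by
      rw [hw]; exact map_dvd _ hx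
    have hpw : algebraMap (Zsqrtd 3) Cyc p ∣ w :=
      (h.dvd_or_dvd hdvd).elim id dvd_of_algebraMap_dvd_star
    exact hp2 (algebraMap_dvd_iff.1 hpw).2
  obtain ⟨r, hr⟩ := exists_associated_norm_of_not_prime hp hnp
  refine ⟨r, hr, fun hass => ?_⟩
  have hrp : Prime r := prime_of_prime_norm (hr.symm.prime hp)
  have hdvd : r ∣ w * star w := by
    rw [hw]
    refine (Dvd.intro (star r) (algebraMap_norm_eq_mul_star r).symm).trans (map_dvd _ ?_)
    exact hr.dvd.trans hx
  have hstar : ∀ z : Cyc, r ∣ z → r ∣ star z := fun z hz =>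
    hass.dvd.trans (map_dvd (starRingEnd Cyc) hz)
  have h1 : r ∣ w := by
    rcases hrp.dvd_or_dvd hdvd with h | h
    · exact h
    · simpa using hstar _ h
  have h2 : r ∣ w - star w := dvd_sub h1 (hstar _ h1)
  have h3 : r.norm ∣ (w - star w).norm := map_dvd _ h2
  have h4 : (w - star w).norm = 2 * 2 := by
    have e : w - star w = ⟨-2 * Zsqrtd.sqrtd, 4⟩ := by
      ext <;> simp [w]
    rw [e]
    decide
  rw [h4] at h3
  exact hp2 ((hp.dvd_or_dvd (hr.symm.dvd.trans h3)).elim id id)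

theorem exists_norm_eq_of_isUnit {u : Zsqrtd 3} (hu : IsUnit u) (hpos : TotPos u) :
    ∃ r : Cyc, r.norm = u := by
  obtain ⟨e, k, he, rfl⟩ := exists_eq_zpow_of_totPos hu hpos
  have h1 : (⟨1, 1⟩ : Cyc).norm = ⟨2, 1⟩ := by decide
  have h2 : IsUnit (⟨1, 1⟩ : Cyc) := by
    rw [isUnit_iff, h1, ← he]; exact e.isUnit
  obtain ⟨r, hr⟩ := h2
  have h3 : Units.map QuadraticAlgebra.norm r = e := by
    ext : 1
    rw [Units.coe_map, he, ← h1, hr]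
  refine ⟨((r ^ k : Cycˣ) : Cyc), ?_⟩
  rw [← h3, ← map_zpow]
  rfl

/-! ### Counting elements of given relative norm -/

/-- The number of elements of `ℤ[ζ₁₂]` of relative norm `ν`. -/
def normCount (ν : Zsqrtd 3) : ℕ := {z : Cyc | z.norm = ν}.ncard

theorem finite_norm_eq (ν : Zsqrtd 3) : {z : Cyc | z.norm = ν}.Finite := by
  let B := Set.Icc (-(2 * |ν.re| + 2)) (2 * |ν.re| + 2)
  have hB : B.Finite := Set.finite_Icc _ _
  refine (((hB.prod hB).prod (hB.prod hB)).image
    (fun t => (⟨⟨t.1.1, t.1.2⟩, ⟨t.2.1, t.2.2⟩⟩ : Cyc))).subset ?_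
  rintro z rfl
  refine ⟨((z.re.re, z.re.im), (z.im.re, z.im.im)), ?_, rfl⟩
  have h := norm_re z
  have h1 := form_nonneg z.re.re z.im.im
  have h2 := form_nonneg z.im.re z.re.im
  have h0 : |z.norm.re| = z.norm.re := abs_of_nonneg (by linarith)
  simp only [B, h0, Set.mem_prod, Set.mem_Icc]
  have bound : ∀ a b n : ℤ, a * a + 3 * a * b + 3 * b * b ≤ n →
      (-(2 * n + 2) ≤ a ∧ a ≤ 2 * n + 2) ∧ (-(2 * n + 2) ≤ b ∧ b ≤ 2 * n + 2) := by
    intro a b n hn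
    have e1 : a * a ≤ 4 * n := by nlinarith [sq_nonneg (a + 2 * b)]
    have e2 : b * b ≤ 4 * n := by nlinarith [sq_nonneg (2 * a + 3 * b)]
    have e3 : 0 ≤ n := by nlinarith [mul_self_nonneg a]
    refine ⟨⟨?_, ?_⟩, ?_, ?_⟩ <;> nlinarith
  obtain ⟨a1, a2⟩ := bound z.re.re z.im.im z.norm.re (by linarith)
  obtain ⟨b1, b2⟩ := bound z.im.re z.re.im z.norm.re (by linarith)
  exact ⟨⟨a1, b2⟩, b1, a2⟩

theorem ncard_dvd_and_norm_eq {r : Cyc} (hr : r ≠ 0) (ν : Zsqrtd 3) :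
    {z : Cyc | r ∣ z ∧ z.norm = r.norm * ν}.ncard = normCount ν := by
  have h : {z : Cyc | r ∣ z ∧ z.norm = r.norm * ν} = (r * ·) '' {z : Cyc | z.norm = ν} := by
    ext z
    constructor
    · rintro ⟨⟨t, rfl⟩, h⟩
      rw [map_mul] at h
      exact ⟨t, mul_left_cancel₀ (fun h0 => hr ((norm_eq_zero_iff r).1 h0)) h, rfl⟩
    · rintro ⟨t, rfl, rfl⟩
      exact ⟨dvd_mul_right _ _, map_mul _ _ _⟩
  rw [h, Set.ncard_image_of_injective _ (mul_right_injective₀ hr), normCount]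

theorem dvd_of_dvd_norm {p : Zsqrtd 3} (hp : Prime (algebraMap (Zsqrtd 3) Cyc p)) {z : Cyc}
    (h : p ∣ z.norm) : algebraMap (Zsqrtd 3) Cyc p ∣ z := by
  have h1 := map_dvd (algebraMap (Zsqrtd 3) Cyc) h
  rw [algebraMap_norm_eq_mul_star] at h1
  exact (hp.dvd_or_dvd h1).elim id dvd_of_algebraMap_dvd_star

theorem normCount_inert_mul {p : Zsqrtd 3} (hp : Prime (algebraMap (Zsqrtd 3) Cyc p))
    (ν : Zsqrtd 3) : normCount (p * (p * ν)) = normCount ν := by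
  rw [← ncard_dvd_and_norm_eq hp.ne_zero ν, normCount]
  congr 1
  ext z
  simp only [Set.mem_ofPred_eq, QuadraticAlgebra.norm_algebraMap, pow_two, mul_assoc]
  exact ⟨fun h => ⟨dvd_of_dvd_norm hp ⟨_, h⟩, h⟩, And.right⟩

theorem normCount_inert_eq_zero {p : Zsqrtd 3} (hp : Prime (algebraMap (Zsqrtd 3) Cyc p))
    {ν : Zsqrtd 3} (hν : ¬ p ∣ ν) : normCount (p * ν) = 0 := by
  have hp0 : p ≠ 0 := by
    rintro rfl
    exact hp.ne_zero (map_zero _)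
  rw [normCount, Set.ncard_eq_zero (finite_norm_eq _), Set.eq_empty_iff_forall_notMem]
  intro z (hz : z.norm = p * ν)
  obtain ⟨t, rfl⟩ := dvd_of_dvd_norm hp ⟨_, hz⟩
  rw [map_mul, QuadraticAlgebra.norm_algebraMap, pow_two, mul_assoc] at hz
  exact hν ⟨_, (mul_left_cancel₀ hp0 hz).symm⟩

theorem normCount_split {r : Cyc} (hr : Prime r) (hass : ¬ Associated r (star r))
    (ν : Zsqrtd 3) : normCount (r.norm * ν) +
      {z : Cyc | algebraMap (Zsqrtd 3) Cyc r.norm ∣ z ∧ z.norm = r.norm * ν}.ncard =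
    2 * normCount ν := by
  have hr' : Prime (star r) := by
    exact (MulEquiv.prime_iff (starRingAut (R := Cyc)).toMulEquiv (p := r)).2 hr
  have h1 := ncard_dvd_and_norm_eq hr.ne_zero ν
  have h2 := ncard_dvd_and_norm_eq hr'.ne_zero ν
  rw [QuadraticAlgebra.norm_star] at h2
  have h3 := Set.ncard_union_add_ncard_inter
    {z : Cyc | r ∣ z ∧ z.norm = r.norm * ν} {z : Cyc | star r ∣ z ∧ z.norm = r.norm * ν}
    ((finite_norm_eq _).subset fun _ h => h.2) ((finite_norm_eq _).subset fun _ h => h.2)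
  rw [h1, h2, ← two_mul] at h3
  rw [← h3, normCount]
  congr 2
  · ext z
    simp only [Set.mem_ofPred_eq, Set.mem_union]
    refine ⟨fun h => ?_, fun h => h.elim And.right And.right⟩
    have hd : r ∣ z * star z := by
      rw [← algebraMap_norm_eq_mul_star, h, map_mul, algebraMap_norm_eq_mul_star, mul_assoc]
      exact dvd_mul_right _ _
    refine (hr.dvd_or_dvd hd).imp (fun h' => ⟨h', h⟩) (fun h' => ⟨?_, h⟩)
    have hs := map_dvd (starRingEnd Cyc) h'
    rwa [starRingEnd_apply, starRingEnd_apply, star_star] at hs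
  · ext z
    simp only [Set.mem_ofPred_eq, Set.mem_inter_iff, algebraMap_norm_eq_mul_star]
    constructor
    · rintro ⟨h, h'⟩
      exact ⟨⟨(dvd_mul_right _ _).trans h, h'⟩, (dvd_mul_left _ _).trans h, h'⟩
    · rintro ⟨⟨⟨t, rfl⟩, h'⟩, h, -⟩
      refine ⟨mul_dvd_mul_left r ?_, h'⟩
      exact (hr'.dvd_or_dvd h).resolve_left fun hh => hass (hr'.associated_of_dvd hr hh).symm

theorem normCount_split_mul {r : Cyc} (hr : Prime r) (hass : ¬ Associated r (star r))
    (ν : Zsqrtd 3) :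
    normCount (r.norm * (r.norm * ν)) + normCount ν = 2 * normCount (r.norm * ν) := by
  have h0 : algebraMap (Zsqrtd 3) Cyc r.norm ≠ 0 := by
    rw [algebraMap_norm_eq_mul_star]
    exact mul_ne_zero hr.ne_zero (star_ne_zero.2 hr.ne_zero)
  rw [← normCount_split hr hass, ← ncard_dvd_and_norm_eq h0 ν]
  simp only [QuadraticAlgebra.norm_algebraMap, pow_two, mul_assoc]

theorem normCount_split_of_not_dvd {r : Cyc} (hr : Prime r) (hass : ¬ Associated r (star r))
    {ν : Zsqrtd 3} (hν : ¬ r.norm ∣ ν) : normCount (r.norm * ν) = 2 * normCount ν := by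
  have h0 : r.norm ≠ 0 := fun h => hr.ne_zero ((norm_eq_zero_iff r).1 h)
  rw [← normCount_split hr hass, left_eq_add, Set.ncard_eq_zero
    ((finite_norm_eq _).subset fun _ h => h.2), Set.eq_empty_iff_forall_notMem]
  rintro z ⟨⟨t, rfl⟩, h⟩
  rw [map_mul, QuadraticAlgebra.norm_algebraMap, pow_two, mul_assoc] at h
  exact hν ⟨_, (mul_left_cancel₀ h0 h).symm⟩

theorem normCount_one : normCount 1 = 12 := by
  let F : Finset ((ℤ × ℤ) × (ℤ × ℤ)) :=
    (((Finset.Icc (-2) 2 ×ˢ Finset.Icc (-1) 1) ×ˢ (Finset.Icc (-2) 2 ×ˢ Finset.Icc (-1) 1))).filter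
      fun t => (⟨⟨t.1.1, t.1.2⟩, ⟨t.2.1, t.2.2⟩⟩ : Cyc).norm = 1
  let f : (ℤ × ℤ) × (ℤ × ℤ) → Cyc := fun t => ⟨⟨t.1.1, t.1.2⟩, ⟨t.2.1, t.2.2⟩⟩
  have hf : Function.Injective f := by
    rintro ⟨⟨a, b⟩, c, d⟩ ⟨⟨a', b'⟩, c', d'⟩ h
    simp only [f, QuadraticAlgebra.mk.injEq, Zsqrtd.mk.injEq] at h
    simp [h]
  have hF : F.card = 12 := by decide +kernel
  have h : {z : Cyc | z.norm = 1} = f '' (F : Set ((ℤ × ℤ) × (ℤ × ℤ))) := by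
    ext z
    constructor
    · intro (hz : z.norm = 1)
      refine ⟨((z.re.re, z.re.im), (z.im.re, z.im.im)), ?_, rfl⟩
      have h := norm_re z
      rw [hz, Zsqrtd.re_one] at h
      have h1 := form_nonneg z.re.re z.im.im
      have h2 := form_nonneg z.im.re z.re.im
      have bound : ∀ a b : ℤ, a * a + 3 * a * b + 3 * b * b ≤ 1 →
          (-2 ≤ a ∧ a ≤ 2) ∧ (-1 ≤ b ∧ b ≤ 1) := by
        intro a b hn
        have e1 : a * a ≤ 4 := by nlinarith [sq_nonneg (a + 2 * b)]
        have e2 : 3 * (b * b) ≤ 4 := by nlinarith [sq_nonneg (2 * a + 3 * b)]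
        refine ⟨⟨?_, ?_⟩, ?_, ?_⟩ <;> nlinarith
      obtain ⟨a1, a2⟩ := bound z.re.re z.im.im (by linarith)
      obtain ⟨b1, b2⟩ := bound z.im.re z.re.im (by linarith)
      simp only [F, Finset.coe_filter, Finset.mem_product, Finset.mem_Icc, Set.mem_ofPred_eq]
      exact ⟨⟨⟨a1, b2⟩, b1, a2⟩, hz⟩
    · rintro ⟨t, ht, rfl⟩
      exact (Finset.mem_filter.1 ht).2
  rw [normCount, h, Set.ncard_image_of_injective _ hf, Set.ncard_coe_finset, hF]

theorem normCount_isUnit {u : Zsqrtd 3} (hu : IsUnit u) (hpos : TotPos u) :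
    normCount u = 12 := by
  obtain ⟨r, rfl⟩ := exists_norm_eq_of_isUnit hu hpos
  have hr := (isUnit_iff r).2 hu
  rw [← normCount_one, ← ncard_dvd_and_norm_eq hr.ne_zero 1, normCount]
  simp [hr.dvd]

/-- A sum of two squares in `ℤ[√3]` is the norm of `x + iy`, with `i = 2ζ - √3`. -/
theorem r2_eq_normCount {ν : Zsqrtd 3} (h : ∀ z : Cyc, z.norm = ν → 2 ∣ z.im) :
    r2 ν = normCount ν := by
  let f : Zsqrtd 3 × Zsqrtd 3 → Cyc := fun t => ⟨t.1 - Zsqrtd.sqrtd * t.2, 2 * t.2⟩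
  have h3 : (Zsqrtd.sqrtd * Zsqrtd.sqrtd : Zsqrtd 3) = 3 := by decide
  have hf : Function.Injective f := by
    rintro ⟨a, b⟩ ⟨c, d⟩ h
    simp only [f, QuadraticAlgebra.mk.injEq] at h
    obtain ⟨h1, h2⟩ := h
    obtain rfl := mul_left_cancel₀ (by decide : (2 : Zsqrtd 3) ≠ 0) h2
    simpa using h1
  have hnorm : ∀ t, (f t).norm = t.1 ^ 2 + t.2 ^ 2 := by
    intro t
    simp only [f, QuadraticAlgebra.norm_def]
    linear_combination (-1) * t.2 ^ 2 * h3
  rw [r2, normCount, ← Set.ncard_image_of_injective _ hf]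
  congr 1
  ext z
  constructor
  · rintro ⟨t, ht, rfl⟩
    exact (hnorm t).trans ht
  · intro hz
    obtain ⟨y, hy⟩ := h z hz
    have e : f (z.re + Zsqrtd.sqrtd * y, y) = z := by
      ext <;> simp [f, hy]
    exact ⟨_, (hnorm _).symm.trans ((congrArg _ e).trans hz), e⟩

end Cyc

/-! ### Divisor sums of multiplicative functions -/

section DivisorSum

variable {M : Type*} [CommMonoidWithZero M] [IsLeftCancelMulZero M] {χ : M → ℤ}

theorem finsum_dvd_prime_mul (hχ : ∀ a b, χ (a * b) = χ a * χ b) {p : M} (hp : Prime p) {m : M}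
    (hfin : {a | a ∣ p * m}.Finite) :
    ∑ᶠ a ∈ {a | a ∣ p * m}, χ a = ∑ᶠ a ∈ {a | a ∣ m}, χ a +
      χ p * ∑ᶠ a ∈ {a | a ∣ m ∧ ¬ p * a ∣ m}, χ a := by
  have h : {a | a ∣ p * m} = {a | a ∣ m} ∪ (p * ·) '' {a | a ∣ m ∧ ¬ p * a ∣ m} := by
    ext a
    constructor
    · rintro ⟨k, hk⟩
      rcases hp.dvd_or_dvd (Dvd.intro m hk) with ⟨b, rfl⟩ | ⟨b, rfl⟩
      · rw [mul_assoc] at hk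
        by_cases hb : p * b ∣ m
        · exact Or.inl hb
        · exact Or.inr ⟨b, ⟨⟨k, mul_left_cancel₀ hp.ne_zero hk⟩, hb⟩, rfl⟩
      · rw [mul_left_comm] at hk
        exact Or.inl ⟨b, mul_left_cancel₀ hp.ne_zero hk⟩
    · rintro (ha | ⟨b, ⟨hb, -⟩, rfl⟩)
      · exact Dvd.dvd.mul_left ha p
      · exact mul_dvd_mul_left p hb
  have hinj : Function.Injective (p * ·) := fun a b => mul_left_cancel₀ hp.ne_zero
  have hfin' := hfin
  rw [h, Set.finite_union, Set.finite_image_iff hinj.injOn] at hfin'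
  rw [h, finsum_mem_union _ hfin'.1 (hfin'.2.image _), finsum_mem_image hinj.injOn,
    mul_finsum_mem]
  · simp only [hχ]
  · rw [Set.disjoint_left]
    rintro _ ha ⟨b, ⟨-, hb⟩, rfl⟩
    exact hb ha

theorem finsum_dvd_prime_mul_of_not_dvd (hχ : ∀ a b, χ (a * b) = χ a * χ b) {p : M}
    (hp : Prime p) {m : M} (hfin : {a | a ∣ p * m}.Finite) (hm : ¬ p ∣ m) :
    ∑ᶠ a ∈ {a | a ∣ p * m}, χ a = (1 + χ p) * ∑ᶠ a ∈ {a | a ∣ m}, χ a := by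
  rw [finsum_dvd_prime_mul hχ hp hfin, one_add_mul]
  simp [fun a => mt (dvd_of_mul_right_dvd (a := p) (b := a)) hm]

theorem finsum_dvd_prime_mul_mul (hχ : ∀ a b, χ (a * b) = χ a * χ b) {p : M}
    (hp : Prime p) {m : M} (hfin : {a | a ∣ p * (p * m)}.Finite) :
    ∑ᶠ a ∈ {a | a ∣ p * (p * m)}, χ a = ∑ᶠ a ∈ {a | a ∣ p * m}, χ a +
      χ p * (∑ᶠ a ∈ {a | a ∣ p * m}, χ a - ∑ᶠ a ∈ {a | a ∣ m}, χ a) := by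
  have hfin₁ : {a | a ∣ p * m}.Finite := hfin.subset fun a ha => Dvd.dvd.mul_left ha p
  have h : {a | a ∣ p * m} = {a | a ∣ m} ∪ {a | a ∣ p * m ∧ ¬ p * a ∣ p * m} := by
    ext a
    simp only [Set.mem_union, Set.mem_ofPred_eq, mul_dvd_mul_iff_left hp.ne_zero]
    exact ⟨fun ha => (em _).imp id fun h => ⟨ha, h⟩,
      fun ha => ha.elim (fun h => Dvd.dvd.mul_left h p) And.left⟩
  have hs : ∑ᶠ a ∈ {a | a ∣ p * m}, χ a = ∑ᶠ a ∈ {a | a ∣ m}, χ a +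
      ∑ᶠ a ∈ {a | a ∣ p * m ∧ ¬ p * a ∣ p * m}, χ a := by
    conv_lhs => rw [h]
    refine finsum_mem_union ?_ (hfin₁.subset fun a ha => Dvd.dvd.mul_left ha p)
      (hfin₁.subset fun a ha => ha.1)
    rw [Set.disjoint_left]
    exact fun a ha ha' => ha'.2 (mul_dvd_mul_left p ha)
  rw [finsum_dvd_prime_mul hχ hp hfin, hs]
  ring

end DivisorSum

/-! ### The character `χ` and its divisor sum -/

open Classical in
theorem chiIdeal_span (μ : Zsqrtd 3) : chiIdeal (Ideal.span {μ}) =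
    if IsCoprime μ pi2 then Int.sign μ.norm else 0 := by
  have h : ∃ ν : Zsqrtd 3, Ideal.span {μ} = Ideal.span {ν} := ⟨μ, rfl⟩
  have hn := norm_eq_of_associated (Ideal.span_singleton_eq_span_singleton.1 h.choose_spec)
  have hcop : Ideal.span {μ} ⊔ Ideal.span {pi2} = ⊤ ↔ IsCoprime μ pi2 := by
    rw [← Ideal.isCoprime_iff_sup_eq, Ideal.isCoprime_span_singleton_iff]
  rw [chiIdeal, dif_pos h, ← hn, p2]
  simp only [hcop]

theorem chiIdeal_mul (I J : Ideal (Zsqrtd 3)) : chiIdeal (I * J) = chiIdeal I * chiIdeal J := by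
  obtain ⟨a, rfl⟩ := (IsPrincipalIdealRing.principal I).principal
  obtain ⟨b, rfl⟩ := (IsPrincipalIdealRing.principal J).principal
  simp only [Ideal.submodule_span_eq]
  rw [Ideal.span_singleton_mul_span_singleton, chiIdeal_span, chiIdeal_span, chiIdeal_span,
    IsCoprime.mul_left_iff, Zsqrtd.norm_mul, Int.sign_mul]
  split_ifs <;> simp_all

theorem chiIdeal_span_of_not_dvd {μ : Zsqrtd 3} (h : ¬ pi2 ∣ μ) :
    chiIdeal (Ideal.span {μ}) = Int.sign μ.norm := by
  rw [chiIdeal_span, if_pos (prime_pi2.irreducible.coprime_iff_not_dvd.2 h).symm]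

theorem chiIdeal_span_pi2 : chiIdeal (Ideal.span {pi2}) = 0 := by
  rw [chiIdeal_span, if_neg]
  rw [isCoprime_self]
  exact prime_pi2.not_isUnit

theorem finite_dvd_span {ν : Zsqrtd 3} (hν : ν ≠ 0) :
    {I : Ideal (Zsqrtd 3) | I ∣ Ideal.span {ν}}.Finite := by
  have := UniqueFactorizationMonoid.fintypeSubtypeDvd (Ideal.span {ν})
    (by simpa [Ideal.zero_eq_bot] using hν)
  exact Set.finite_coe_iff.1 (Finite.of_fintype {I // I ∣ Ideal.span {ν}})

theorem sigmaChi_mul_of_not_dvd {p ν : Zsqrtd 3} (hp : Prime p) (hν : ν ≠ 0) (h : ¬ p ∣ ν) :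
    sigmaChi (p * ν) = (1 + chiIdeal (Ideal.span {p})) * sigmaChi ν := by
  have hfin := finite_dvd_span (mul_ne_zero hp.ne_zero hν)
  rw [← Ideal.span_singleton_mul_span_singleton] at hfin
  rw [sigmaChi, sigmaChi, ← Ideal.span_singleton_mul_span_singleton]
  refine finsum_dvd_prime_mul_of_not_dvd chiIdeal_mul (Ideal.prime_span_singleton_iff.2 hp) hfin ?_
  rwa [Ideal.span_singleton_dvd_span_singleton_iff_dvd]

theorem sigmaChi_mul_mul {p ν : Zsqrtd 3} (hp : Prime p) (hν : ν ≠ 0) :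
    sigmaChi (p * (p * ν)) = sigmaChi (p * ν) +
      chiIdeal (Ideal.span {p}) * (sigmaChi (p * ν) - sigmaChi ν) := by
  have hfin := finite_dvd_span (mul_ne_zero hp.ne_zero (mul_ne_zero hp.ne_zero hν))
  simp only [← Ideal.span_singleton_mul_span_singleton] at hfin
  simp only [sigmaChi, ← Ideal.span_singleton_mul_span_singleton]
  exact finsum_dvd_prime_mul_mul chiIdeal_mul (Ideal.prime_span_singleton_iff.2 hp) hfin

theorem sigmaChi_pi2_mul {ν : Zsqrtd 3} (hν : ν ≠ 0) : sigmaChi (pi2 * ν) = sigmaChi ν := by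
  by_cases h : pi2 ∣ ν
  · obtain ⟨ν, rfl⟩ := h
    rw [sigmaChi_mul_mul prime_pi2 (right_ne_zero_of_mul hν), chiIdeal_span_pi2]
    ring
  · rw [sigmaChi_mul_of_not_dvd prime_pi2 hν h, chiIdeal_span_pi2]
    ring

theorem sigmaChi_isUnit {u : Zsqrtd 3} (hu : IsUnit u) : sigmaChi u = 1 := by
  have h : {I : Ideal (Zsqrtd 3) | I ∣ Ideal.span {u}} = {Ideal.span {1}} := by
    ext I
    rw [Ideal.span_singleton_eq_top.2 hu, Ideal.span_singleton_one, ← Ideal.one_eq_top]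
    exact isUnit_iff_dvd_one.symm.trans isUnit_iff_eq_one
  rw [sigmaChi, h, finsum_mem_singleton,
    chiIdeal_span_of_not_dvd fun h1 => prime_pi2.not_isUnit (isUnit_of_dvd_one h1)]
  simp [Zsqrtd.norm_one]

theorem natAbs_norm_lt_mul {p ν : Zsqrtd 3} (hp : ¬ IsUnit p) (h : p * ν ≠ 0) :
    ν.norm.natAbs < (p * ν).norm.natAbs := by
  have hp0 : p.norm ≠ 0 := fun h0 => left_ne_zero_of_mul h ((norm_eq_zero_iff p).1 h0)
  have hν0 : ν.norm ≠ 0 := fun h0 => right_ne_zero_of_mul h ((norm_eq_zero_iff ν).1 h0)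
  have hp1 : p.norm.natAbs ≠ 1 := fun h1 => hp (Zsqrtd.norm_eq_one_iff.1 h1)
  rw [Zsqrtd.norm_mul, Int.natAbs_mul]
  exact lt_mul_of_one_lt_left (Int.natAbs_pos.2 hν0) (by omega)

theorem normCount_eq_of_not_dvd (ν : Zsqrtd 3) (hpos : TotPos ν) (hodd : ¬ pi2 ∣ ν) :
    (Cyc.normCount ν : ℤ) = 12 * sigmaChi ν := by
  induction hn : ν.norm.natAbs using Nat.strong_induction_on generalizing ν with
  | _ n ih =>
  subst hn
  by_cases hu : IsUnit ν
  · rw [Cyc.normCount_isUnit hu hpos, sigmaChi_isUnit hu]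
    rfl
  obtain ⟨p, hp, hpν⟩ := WfDvdMonoid.exists_irreducible_factor hu hpos.ne_zero
  rw [irreducible_iff_prime] at hp
  have hp2 : ¬ pi2 ∣ p := fun h => hodd (h.trans hpν)
  have hn0 : p.norm ≠ 0 := fun h => hp.ne_zero ((norm_eq_zero_iff p).1 h)
  rcases lt_or_gt_of_ne hn0 with hneg | hppos
  · have hinert := Cyc.prime_algebraMap_of_norm_neg hp hneg
    have hχ : chiIdeal (Ideal.span {p}) = -1 := by
      rw [chiIdeal_span_of_not_dvd hp2, Int.sign_eq_neg_one_of_neg hneg]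
    obtain ⟨ν, rfl⟩ := hpν
    have hν0 := right_ne_zero_of_mul hpos.ne_zero
    by_cases h : p ∣ ν
    · obtain ⟨ν, rfl⟩ := h
      rw [Cyc.normCount_inert_mul hinert, sigmaChi_mul_mul hp (right_ne_zero_of_mul hν0), hχ,
        ih _ ?_ ν ?_ ?_ rfl]
      · ring
      · exact (natAbs_norm_lt_mul hp.not_isUnit hν0).trans
          (natAbs_norm_lt_mul hp.not_isUnit hpos.ne_zero)
      · rw [← mul_assoc] at hpos
        exact (totPos_mul_self hp.ne_zero).mul_iff.1 hpos
      · exact fun h => hodd ((h.mul_left p).mul_left p)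
    · rw [Cyc.normCount_inert_eq_zero hinert h, sigmaChi_mul_of_not_dvd hp hν0 h, hχ]
      simp
  · obtain ⟨r, hr, hass⟩ := Cyc.exists_split hp hp2 hppos
    have hq := hr.symm.prime hp
    have hrp := Cyc.prime_of_prime_norm hq
    have hqpos := Cyc.totPos_norm hrp.ne_zero
    have hχ : chiIdeal (Ideal.span {r.norm}) = 1 := by
      rw [Ideal.span_singleton_eq_span_singleton.2 hr, chiIdeal_span_of_not_dvd hp2,
        Int.sign_eq_one_of_pos hppos]
    obtain ⟨ν, rfl⟩ := hr.dvd.trans hpν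
    have hν0 := right_ne_zero_of_mul hpos.ne_zero
    have hνpos := hqpos.mul_iff.1 hpos
    have h1 := ih _ (natAbs_norm_lt_mul hq.not_isUnit hpos.ne_zero) ν hνpos
      (fun h => hodd (h.mul_left _)) rfl
    by_cases h : r.norm ∣ ν
    · obtain ⟨ν, rfl⟩ := h
      have h2 := ih _ ((natAbs_norm_lt_mul hq.not_isUnit hν0).trans
        (natAbs_norm_lt_mul hq.not_isUnit hpos.ne_zero)) ν (hqpos.mul_iff.1 hνpos)
        (fun h => hodd ((h.mul_left _).mul_left _)) rfl
      have h3 := Cyc.normCount_split_mul hrp hass ν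
      zify at h3
      rw [sigmaChi_mul_mul hq (right_ne_zero_of_mul hν0), hχ]
      linear_combination h3 + 2 * h1 - h2
    · rw [Cyc.normCount_split_of_not_dvd hrp hass h, sigmaChi_mul_of_not_dvd hq hν0 h, hχ]
      push_cast
      rw [h1]
      ring

theorem prime_algebraMap_pi2 : Prime (algebraMap (Zsqrtd 3) Cyc pi2) :=
  Cyc.prime_algebraMap_of_norm_neg prime_pi2 (by decide)

theorem normCount_pi2_pow_mul (w : ℕ) (ν : Zsqrtd 3) :
    Cyc.normCount (pi2 ^ (w + w) * ν) = Cyc.normCount ν := by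
  induction w with
  | zero => simp
  | succ w ih =>
    rw [← ih, ← Cyc.normCount_inert_mul prime_algebraMap_pi2 (pi2 ^ (w + w) * ν)]
    congr 1
    ring

theorem sigmaChi_pi2_pow_mul (k : ℕ) {ν : Zsqrtd 3} (hν : ν ≠ 0) :
    sigmaChi (pi2 ^ k * ν) = sigmaChi ν := by
  induction k with
  | zero => simp
  | succ k ih =>
    rw [pow_succ', mul_assoc, sigmaChi_pi2_mul (mul_ne_zero (pow_ne_zero _ prime_pi2.ne_zero) hν),
      ih]

theorem two_dvd_im_of_norm_eq {z : Cyc} {ν : Zsqrtd 3} (h : z.norm = pi2 ^ 4 * ν) :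
    2 ∣ z.im := by
  have hdvd : ∀ (y : Cyc) (μ : Zsqrtd 3), y.norm = pi2 * (pi2 * μ) →
      ∃ t, y = algebraMap (Zsqrtd 3) Cyc pi2 * t ∧ t.norm = μ := by
    intro y μ hy
    obtain ⟨t, rfl⟩ := Cyc.dvd_of_dvd_norm prime_algebraMap_pi2 ⟨_, hy⟩
    refine ⟨t, rfl, ?_⟩
    rw [map_mul, QuadraticAlgebra.norm_algebraMap, pow_two, mul_assoc] at hy
    exact mul_left_cancel₀ prime_pi2.ne_zero (mul_left_cancel₀ prime_pi2.ne_zero hy)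
  obtain ⟨t, rfl, ht⟩ := hdvd z (pi2 * (pi2 * ν)) (by rw [h]; ring)
  obtain ⟨s, rfl, -⟩ := hdvd t ν ht
  have h2 : pi2 * pi2 = 2 * ⟨2, 1⟩ := by decide
  rw [← mul_assoc, ← map_mul, h2]
  refine ⟨⟨2, 1⟩ * s.im, ?_⟩
  simp [mul_assoc]

/-- Let ν be totally positive and let v be the exponent of 𝔭₂ in (ν).
If v is even and v ≥ 4, then r_{2,K}(ν) = 12·σ_{0,χ}(ν). -/
theorem two_squares_count_high (ν : Zsqrtd 3) (v : ℕ) (hpos : TotPos ν)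
    (hv1 : p2 ^ v ∣ Ideal.span {ν}) (hv2 : ¬ p2 ^ (v + 1) ∣ Ideal.span {ν})
    (heven : Even v) (h4 : 4 ≤ v) :
    (r2 ν : ℤ) = 12 * sigmaChi ν := by
  rw [p2, Ideal.span_singleton_pow, Ideal.span_singleton_dvd_span_singleton_iff_dvd] at hv1 hv2
  obtain ⟨μ, rfl⟩ := hv1
  obtain ⟨w, rfl⟩ := heven
  have hμ : ¬ pi2 ∣ μ := fun h => hv2 (pow_succ pi2 (w + w) ▸ mul_dvd_mul_left _ h)
  have hμpos : TotPos μ := by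
    rw [pow_add] at hpos
    exact (totPos_mul_self (pow_ne_zero w prime_pi2.ne_zero)).mul_iff.1 hpos
  obtain ⟨k, hk⟩ := Nat.exists_eq_add_of_le h4
  rw [Cyc.r2_eq_normCount fun z hz => two_dvd_im_of_norm_eq (ν := pi2 ^ k * μ)
      (by rw [hz, hk, pow_add, mul_assoc]),
    normCount_pi2_pow_mul, sigmaChi_pi2_pow_mul _ hμpos.ne_zero,
    normCount_eq_of_not_dvd μ hμpos hμ]

end Paper3
end
end

section
/- Let ν ∈ O_K with π₂ ∤ ν, and assume ν is a sum of two squares in O_K (i.e., ν = u² + w² for some u, w ∈ O_K). Then every pair x₁, x₂ ∈ O_K with x₁² + x₂² = π₂²·ν satisfies π₂ ∣ x₁ and π₂ ∣ x₂. -/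
/-!
Statements about sums of squares in K = ℚ(√3), with ring of integers O_K = ℤ[√3],
realized as `Zsqrtd 3`.
-/

noncomputable section

namespace Paper3

/-- `π₂` divides `a + b√3` exactly when `a` and `b` have the same parity. -/
theorem pi2_dvd_iff (x : Zsqrtd 3) : pi2 ∣ x ↔ (Even x.re ↔ Even x.im) := by
  rw [← Int.even_sub]
  constructor
  · rintro ⟨y, rfl⟩
    refine ⟨y.im, ?_⟩
    simp only [pi2, Zsqrtd.re_mul, Zsqrtd.im_mul]
    ring
  · rintro ⟨k, hk⟩
    refine ⟨⟨x.im - k, k⟩, ?_⟩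
    ext <;> simp only [pi2, Zsqrtd.re_mul, Zsqrtd.im_mul] <;> linarith

/-- If π₂ ∤ ν and ν is a sum of two squares in O_K, then every
x₁, x₂ ∈ O_K with x₁² + x₂² = π₂²·ν satisfy π₂ ∣ x₁ and π₂ ∣ x₂. -/
theorem descent_odd (ν : Zsqrtd 3) (hodd : ¬ pi2 ∣ ν)
    (hrep : ∃ u w : Zsqrtd 3, u ^ 2 + w ^ 2 = ν)
    (x₁ x₂ : Zsqrtd 3) (hx : x₁ ^ 2 + x₂ ^ 2 = pi2 ^ 2 * ν) :
    pi2 ∣ x₁ ∧ pi2 ∣ x₂ := by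
  obtain ⟨u, w, rfl⟩ := hrep
  rw [pi2_dvd_iff] at hodd ⊢
  rw [pi2_dvd_iff]
  have him_even : Even (u ^ 2 + w ^ 2).im := by
    refine ⟨u.re * u.im + w.re * w.im, ?_⟩
    simp only [sq, Zsqrtd.im_add, Zsqrtd.im_mul]
    ring
  generalize u ^ 2 + w ^ 2 = ν at *
  have hre := congrArg Zsqrtd.re hx
  have him := congrArg Zsqrtd.im hx
  simp only [pi2, sq, Zsqrtd.re_add, Zsqrtd.im_add, Zsqrtd.re_mul, Zsqrtd.im_mul] at hre him
  have hre' : Even (x₁.re * x₁.re + x₁.im * x₁.im + (x₂.re * x₂.re + x₂.im * x₂.im)) :=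
    ⟨2 * ν.re + 3 * ν.im - x₁.im * x₁.im - x₂.im * x₂.im, by linarith⟩
  have him' : x₁.re * x₁.im + x₂.re * x₂.im = ν.re + ν.im + ν.im := by linarith
  have hodd' : ¬ Even (x₁.re * x₁.im + x₂.re * x₂.im) := by
    rw [him']
    simp only [Int.even_add]
    tauto
  simp only [Int.even_add, Int.even_mul] at hre' hodd'
  tauto

end Paper3
end
end
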